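/- Let R_1, …, R_n (n ≥ 4) be a rectangular floorplan of a rectangle R = [A,B] × [C,D]. Then the adjacency graph of the floorplan has at most 3n − 7 edges; that is, the number of unordered pairs {i, j} with i ≠ j such that R_i ∩ R_j contains more than one point is at most 3n − 7. -/

import Mathlib

open Set

/-- The closed axis-aligned rectangle `[a,b] × [c,d]` in the plane. -/
def Rect (a b c d : ℝ) : Set (ℝ × ℝ) := Set.Icc a b ×ˢ Set.Icc c d

/-- `IsRFP A B C D a b c d` says that the family of rectangles
`[a k, b k] × [c k, d k]` is a rectangular floorplan of `[A,B] × [C,D]`: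
each member is a nondegenerate rectangle, their union is the big rectangle,
their (open) interiors are pairwise disjoint, and no point lies in four of them. -/
def IsRFP {ι : Type*} [Fintype ι] (A B C D : ℝ) (a b c d : ι → ℝ) : Prop :=
  A < B ∧ C < D ∧
  (∀ k, a k < b k ∧ c k < d k) ∧
  (⋃ k, Rect (a k) (b k) (c k) (d k)) = Rect A B C D ∧
  ((Set.univ : Set ι).Pairwise fun i j =>
    Disjoint (Set.Ioo (a i) (b i) ×ˢ Set.Ioo (c i) (d i))
             (Set.Ioo (a j) (b j) ×ˢ Set.Ioo (c j) (d j))) ∧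
  (∀ p : ℝ × ℝ, {k : ι | p ∈ Rect (a k) (b k) (c k) (d k)}.ncard ≤ 3)

/-- The adjacency graph of a family of rectangles: `i ~ j` iff `i ≠ j` and
the intersection of the two rectangles contains more than one point. -/
def adjGraph {ι : Type*} (a b c d : ι → ℝ) : SimpleGraph ι :=
  SimpleGraph.fromRel fun i j =>
    (Rect (a i) (b i) (c i) (d i) ∩ Rect (a j) (b j) (c j) (d j)).Nontrivial


/-- Working form of the floorplan axioms. -/
structure FP {ι : Type} (A B C D : ℝ) (a b c d : ι → ℝ) : Prop where
  hAB : A < B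
  hCD : C < D
  ab : ∀ k, a k < b k
  cd : ∀ k, c k < d k
  hA : ∀ k, A ≤ a k
  hB : ∀ k, b k ≤ B
  hC : ∀ k, C ≤ c k
  hD : ∀ k, d k ≤ D
  sep : ∀ i j, i ≠ j → b i ≤ a j ∨ b j ≤ a i ∨ d i ≤ c j ∨ d j ≤ c i
  cov : ∀ x y, A ≤ x → x ≤ B → C ≤ y → y ≤ D →
    ∃ k, a k ≤ x ∧ x ≤ b k ∧ c k ≤ y ∧ y ≤ d k

theorem FP.refl_x {ι : Type} {A B C D : ℝ} {a b c d : ι → ℝ} (h : FP A B C D a b c d) :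
    FP (-B) (-A) C D (fun k => - b k) (fun k => - a k) c d where
  hAB := by linarith [h.hAB]
  hCD := h.hCD
  ab k := by linarith [h.ab k]
  cd := h.cd
  hA k := by linarith [h.hB k]
  hB k := by linarith [h.hA k]
  hC := h.hC
  hD := h.hD
  sep i j hij := by
    rcases h.sep i j hij with h | h | h | h
    · right; left; linarith
    · left; linarith
    · simp [h]
    · simp [h]
  cov x y h1 h2 h3 h4 := by
    obtain ⟨k, hk⟩ := h.cov (-x) y (by linarith) (by linarith) h3 h4
    exact ⟨k, by linarith, by linarith, hk.2.2⟩

theorem FP.transp {ι : Type} {A B C D : ℝ} {a b c d : ι → ℝ} (h : FP A B C D a b c d) :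
    FP C D A B c d a b where
  hAB := h.hCD
  hCD := h.hAB
  ab := h.cd
  cd := h.ab
  hA := h.hC
  hB := h.hD
  hC := h.hA
  hD := h.hB
  sep i j hij := by
    have := h.sep i j hij
    tauto
  cov x y h1 h2 h3 h4 := by
    obtain ⟨k, hk⟩ := h.cov y x h3 h4 h1 h2
    exact ⟨k, by tauto⟩

theorem FP.of_rfp {n : ℕ} {A B C D : ℝ} {a b c d : Fin n → ℝ}
    (h : IsRFP A B C D a b c d) : FP A B C D a b c d := by
  obtain ⟨hAB, hCD, hpos, hU, hdis, -⟩ := h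
  have hsub : ∀ k x y, a k ≤ x → x ≤ b k → c k ≤ y → y ≤ d k →
      (A ≤ x ∧ x ≤ B) ∧ (C ≤ y ∧ y ≤ D) := by
    intro k x y h1 h2 h3 h4
    have : (x, y) ∈ Rect A B C D := by
      rw [← hU]
      exact mem_iUnion.2 ⟨k, ⟨h1, h2⟩, ⟨h3, h4⟩⟩
    exact this
  have h1 := fun k => hsub k (a k) (c k) le_rfl (hpos k).1.le le_rfl (hpos k).2.le
  have h2 := fun k => hsub k (b k) (d k) (hpos k).1.le le_rfl (hpos k).2.le le_rfl
  refine ⟨hAB, hCD, fun k => (hpos k).1, fun k => (hpos k).2, fun k => (h1 k).1.1,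
    fun k => (h2 k).1.2, fun k => (h1 k).2.1, fun k => (h2 k).2.2, ?_, ?_⟩
  · intro i j hij
    by_contra! hc
    obtain ⟨e1, e2, e3, e4⟩ := hc
    have := hdis (mem_univ i) (mem_univ j) hij
    obtain ⟨x, hx1, hx2⟩ := exists_between
      (show max (a i) (a j) < min (b i) (b j) by simp [hpos, e1, e2])
    obtain ⟨y, hy1, hy2⟩ := exists_between
      (show max (c i) (c j) < min (d i) (d j) by simp [hpos, e3, e4])
    simp only [max_lt_iff, lt_min_iff] at hx1 hx2 hy1 hy2
    exact Set.disjoint_left.1 this (show (x, y) ∈ _ from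
      ⟨⟨hx1.1, hx2.1⟩, ⟨hy1.1, hy2.1⟩⟩) ⟨⟨hx1.2, hx2.2⟩, ⟨hy1.2, hy2.2⟩⟩
  · intro x y e1 e2 e3 e4
    have : (x, y) ∈ Rect A B C D := ⟨⟨e1, e2⟩, ⟨e3, e4⟩⟩
    rw [← hU] at this
    obtain ⟨k, hk⟩ := mem_iUnion.1 this
    exact ⟨k, hk.1.1, hk.1.2, hk.2.1, hk.2.2⟩

/-- Half-open covering. -/
theorem FP.cov_ll {ι : Type} [Finite ι] {A B C D : ℝ} {a b c d : ι → ℝ}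
    (h : FP A B C D a b c d) (x y : ℝ) (h1 : A ≤ x) (h2 : x < B) (h3 : C ≤ y) (h4 : y < D) :
    ∃ k, (a k ≤ x ∧ x < b k) ∧ (c k ≤ y ∧ y < d k) := by
  have ev : ∀ᶠ ε : ℝ in nhdsWithin 0 (Ioi 0), ∃ k, a k ≤ x + ε ∧ x + ε ≤ b k ∧
      c k ≤ y + ε ∧ y + ε ≤ d k := by
    have hm : (0:ℝ) < min (B - x) (D - y) := by simp [h2, h4]
    filter_upwards [Ioo_mem_nhdsGT hm] with ε hε
    obtain ⟨e1, e2⟩ := hε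
    rw [lt_min_iff] at e2
    exact h.cov _ _ (by linarith) (by linarith) (by linarith) (by linarith)
  have fr := ev.frequently
  rw [Filter.frequently_exists] at fr
  obtain ⟨k, hk⟩ := fr
  have pos : ∀ᶠ ε : ℝ in nhdsWithin 0 (Ioi 0), 0 < ε := self_mem_nhdsWithin
  refine ⟨k, ⟨?_, ?_⟩, ?_, ?_⟩
  · by_contra! hc
    have : ∀ᶠ ε : ℝ in nhdsWithin 0 (Ioi 0), ε < a k - x :=
      Filter.mem_of_superset (Ioo_mem_nhdsGT (show (0:ℝ) < a k - x by linarith)) fun _ h => h.2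
    obtain ⟨ε, e1, e2⟩ := (hk.and_eventually this).exists
    linarith
  · obtain ⟨ε, e1, e2⟩ := (hk.and_eventually pos).exists
    linarith
  · by_contra! hc
    have : ∀ᶠ ε : ℝ in nhdsWithin 0 (Ioi 0), ε < c k - y :=
      Filter.mem_of_superset (Ioo_mem_nhdsGT (show (0:ℝ) < c k - y by linarith)) fun _ h => h.2
    obtain ⟨ε, e1, e2⟩ := (hk.and_eventually this).exists
    linarith
  · obtain ⟨ε, e1, e2⟩ := (hk.and_eventually pos).exists
    linarith

open Classical in
noncomputable def lo (a b x : ℝ) : ℕ := if a ≤ x ∧ x < b then 1 else 0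

open Classical in
noncomputable def hi (a b x : ℝ) : ℕ := if a < x ∧ x ≤ b then 1 else 0

theorem lo_neg (a b x : ℝ) : lo (-b) (-a) (-x) = hi a b x := by
  unfold lo hi
  congr 1
  simp only [neg_le_neg_iff, neg_lt_neg_iff, eq_iff_iff]
  tauto

theorem FP.sum_ll {ι : Type} [Fintype ι] {A B C D : ℝ} {a b c d : ι → ℝ}
    (h : FP A B C D a b c d) (x y : ℝ) :
    ∑ k, lo (a k) (b k) x * lo (c k) (d k) y = lo A B x * lo C D y := by
  classical
  by_cases hp : (A ≤ x ∧ x < B) ∧ (C ≤ y ∧ y < D)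
  · obtain ⟨k, hk⟩ := h.cov_ll x y hp.1.1 hp.1.2 hp.2.1 hp.2.2
    rw [Finset.sum_eq_single k]
    · simp [lo, hk, hp]
    · intro j _ hj
      have := h.sep j k hj
      by_contra hne
      have hj2 : (a j ≤ x ∧ x < b j) ∧ (c j ≤ y ∧ y < d j) := by
        unfold lo at hne
        split_ifs at hne <;> simp_all
      rcases this with h | h | h | h <;> linarith [hj2.1.1, hj2.1.2, hj2.2.1, hj2.2.2,
        hk.1.1, hk.1.2, hk.2.1, hk.2.2]
    · simp
  · have hr : lo A B x * lo C D y = 0 := by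
      unfold lo
      split_ifs <;> simp_all
    rw [hr]
    apply Finset.sum_eq_zero
    intro j _
    by_contra hne
    have hj2 : (a j ≤ x ∧ x < b j) ∧ (c j ≤ y ∧ y < d j) := by
      unfold lo at hne
      split_ifs at hne <;> simp_all
    apply hp
    have := h.hA j
    have := h.hB j
    have := h.hC j
    have := h.hD j
    refine ⟨⟨?_, ?_⟩, ?_, ?_⟩ <;> linarith [hj2.1.1, hj2.1.2, hj2.2.1, hj2.2.2]

noncomputable def wt (a b x : ℝ) : ℕ := lo a b x + hi a b x

theorem FP.sum_hl {ι : Type} [Fintype ι] {A B C D : ℝ} {a b c d : ι → ℝ}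
    (h : FP A B C D a b c d) (x y : ℝ) :
    ∑ k, hi (a k) (b k) x * lo (c k) (d k) y = hi A B x * lo C D y := by
  have := h.refl_x.sum_ll (-x) y
  simpa only [lo_neg] using this

theorem FP.sum_lh {ι : Type} [Fintype ι] {A B C D : ℝ} {a b c d : ι → ℝ}
    (h : FP A B C D a b c d) (x y : ℝ) :
    ∑ k, lo (a k) (b k) x * hi (c k) (d k) y = lo A B x * hi C D y := by
  have := h.transp.sum_hl y x
  simpa only [mul_comm] using this

theorem FP.sum_hh {ι : Type} [Fintype ι] {A B C D : ℝ} {a b c d : ι → ℝ}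
    (h : FP A B C D a b c d) (x y : ℝ) :
    ∑ k, hi (a k) (b k) x * hi (c k) (d k) y = hi A B x * hi C D y := by
  have := h.refl_x.sum_lh (-x) y
  simpa only [lo_neg] using this

theorem FP.sum_wt {ι : Type} [Fintype ι] {A B C D : ℝ} {a b c d : ι → ℝ}
    (h : FP A B C D a b c d) (x y : ℝ) :
    ∑ k, wt (a k) (b k) x * wt (c k) (d k) y = wt A B x * wt C D y := by
  simp only [wt, add_mul, mul_add, Finset.sum_add_distrib, h.sum_ll, h.sum_hl, h.sum_lh, h.sum_hh]

theorem wt_in {a b x : ℝ} (h1 : a < x) (h2 : x < b) : wt a b x = 2 := by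
  simp [wt, lo, hi, h1, h2, h1.le, h2.le]

theorem wt_end {a b x : ℝ} (h : a < b) (h1 : x = a ∨ x = b) : wt a b x = 1 := by
  rcases h1 with rfl | rfl <;> simp [wt, lo, hi, h, h.le]

theorem wt_out {a b x : ℝ} (h1 : ¬ (a ≤ x ∧ x ≤ b)) : wt a b x = 0 := by
  have e1 : ¬ (a ≤ x ∧ x < b) := fun h => h1 ⟨h.1, h.2.le⟩
  have e2 : ¬ (a < x ∧ x ≤ b) := fun h => h1 ⟨h.1.le, h.2⟩
  simp [wt, lo, hi, e1, e2]

theorem wt_pos {a b x : ℝ} (h : a < b) (h1 : a ≤ x) (h2 : x ≤ b) : 1 ≤ wt a b x := by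
  by_cases hx : x = a ∨ x = b
  · rw [wt_end h hx]
  · push Not at hx
    rw [wt_in (lt_of_le_of_ne h1 (Ne.symm hx.1)) (lt_of_le_of_ne h2 hx.2)]
    norm_num

def IsEnd (a b x : ℝ) : Prop := x = a ∨ x = b

theorem wt_cases {a b : ℝ} (h : a < b) (x : ℝ) :
    (IsEnd a b x ∧ wt a b x = 1) ∨ (¬ IsEnd a b x ∧ (wt a b x = 0 ∨ wt a b x = 2)) := by
  by_cases hx : x = a ∨ x = b
  · exact Or.inl ⟨hx, wt_end h hx⟩
  · refine Or.inr ⟨hx, ?_⟩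
    by_cases h1 : a ≤ x ∧ x ≤ b
    · push Not at hx
      right
      exact wt_in (lt_of_le_of_ne h1.1 (Ne.symm hx.1)) (lt_of_le_of_ne h1.2 hx.2)
    · left
      exact wt_out h1

open Classical in
/-- rectangles having `p` as a corner -/
noncomputable def crn {ι : Type} [Fintype ι] (a b c d : ι → ℝ) (p : ℝ × ℝ) : Finset ι :=
  Finset.univ.filter fun k => IsEnd (a k) (b k) p.1 ∧ IsEnd (c k) (d k) p.2

open Classical in
/-- rectangles containing `p` -/
noncomputable def cont {ι : Type} [Fintype ι] (a b c d : ι → ℝ) (p : ℝ × ℝ) : Finset ι :=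
  Finset.univ.filter fun k => p ∈ Rect (a k) (b k) (c k) (d k)

theorem FP.crn_parity {ι : Type} [Fintype ι] {A B C D : ℝ} {a b c d : ι → ℝ}
    (h : FP A B C D a b c d) (p : ℝ × ℝ) :
    (crn a b c d p).card % 2 = (wt A B p.1 * wt C D p.2) % 2 := by
  classical
  rw [← h.sum_wt, crn, Finset.card_filter]
  rw [Finset.sum_nat_mod, Finset.sum_nat_mod (f := fun k => wt (a k) (b k) p.1 * wt (c k) (d k) p.2)]
  congr 1
  apply Finset.sum_congr rfl
  intro k _
  rcases wt_cases (h.ab k) p.1 with ⟨e1, e2⟩ | ⟨e1, e2 | e2⟩ <;>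
  rcases wt_cases (h.cd k) p.2 with ⟨e3, e4⟩ | ⟨e3, e4 | e4⟩ <;> simp [e1, e2, e3, e4]

theorem FP.cont_le {ι : Type} [Fintype ι] {A B C D : ℝ} {a b c d : ι → ℝ}
    (h : FP A B C D a b c d) (p : ℝ × ℝ) :
    (cont a b c d p).card ≤ wt A B p.1 * wt C D p.2 := by
  classical
  rw [← h.sum_wt, cont, Finset.card_filter]
  apply Finset.sum_le_sum
  intro k _
  split_ifs with hk
  · exact Nat.mul_pos (wt_pos (h.ab k) hk.1.1 hk.1.2) (wt_pos (h.cd k) hk.2.1 hk.2.2)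
  · simp

/-- Boundary (non-corner) junctions. -/
def IsBd {ι : Type} (A B C D : ℝ) (a b c d : ι → ℝ) (p : ℝ × ℝ) : Prop :=
  (∃ k, IsEnd (a k) (b k) p.1 ∧ IsEnd (c k) (d k) p.2) ∧
    (((A < p.1 ∧ p.1 < B) ∧ IsEnd C D p.2) ∨ ((C < p.2 ∧ p.2 < D) ∧ IsEnd A B p.1))

def Many {ι : Type} (A B C D : ℝ) (a b c d : ι → ℝ) : Prop :=
  ∃ S : Finset (ℝ × ℝ), 4 ≤ S.card ∧ ∀ p ∈ S, IsBd A B C D a b c d p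

theorem Many.refl_x {ι : Type} {A B C D : ℝ} {a b c d : ι → ℝ}
    (h : Many (-B) (-A) C D (fun k => - b k) (fun k => - a k) c d) : Many A B C D a b c d := by
  classical
  obtain ⟨S, h4, hS⟩ := h
  refine ⟨S.map ((Equiv.neg ℝ).prodCongr (Equiv.refl ℝ)).toEmbedding, by simpa using h4, ?_⟩
  intro p hp
  obtain ⟨q, hq, rfl⟩ := Finset.mem_map.1 hp
  obtain ⟨⟨k, h1, h2⟩, h3⟩ := hS q hq
  refine ⟨⟨k, ?_, h2⟩, ?_⟩
  · simp only [IsEnd] at *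
    simp only [Equiv.coe_toEmbedding, Equiv.prodCongr_apply, Prod.map, Equiv.neg_apply]
    rcases h1 with h1 | h1 <;> simp [h1]
  · simp only [IsEnd] at *
    simp only [Equiv.coe_toEmbedding, Equiv.prodCongr_apply, Prod.map, Equiv.neg_apply, Equiv.refl_apply]
    rcases h3 with ⟨h3, h5⟩ | ⟨h3, h5⟩
    · left
      exact ⟨⟨by linarith, by linarith⟩, h5⟩
    · right
      refine ⟨h3, ?_⟩
      rcases h5 with h5 | h5 <;> simp [h5]

theorem Many.transp {ι : Type} {A B C D : ℝ} {a b c d : ι → ℝ}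
    (h : Many C D A B c d a b) : Many A B C D a b c d := by
  classical
  obtain ⟨S, h4, hS⟩ := h
  refine ⟨S.map (Equiv.prodComm ℝ ℝ).toEmbedding, by simpa using h4, ?_⟩
  intro p hp
  obtain ⟨q, hq, rfl⟩ := Finset.mem_map.1 hp
  obtain ⟨⟨k, h1, h2⟩, h3⟩ := hS q hq
  exact ⟨⟨k, h2, h1⟩, h3.symm⟩

theorem FP.corner_ll {ι : Type} [Finite ι] {A B C D : ℝ} {a b c d : ι → ℝ}
    (h : FP A B C D a b c d) : ∃ k, a k = A ∧ c k = C := by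
  obtain ⟨k, hk⟩ := h.cov_ll A C le_rfl h.hAB le_rfl h.hCD
  exact ⟨k, le_antisymm hk.1.1 (h.hA k), le_antisymm hk.2.1 (h.hC k)⟩

theorem FP.corner_hl {ι : Type} [Finite ι] {A B C D : ℝ} {a b c d : ι → ℝ}
    (h : FP A B C D a b c d) : ∃ k, b k = B ∧ c k = C := by
  obtain ⟨k, h1, h2⟩ := h.refl_x.corner_ll
  exact ⟨k, by linarith, h2⟩

theorem FP.corner_hh {ι : Type} [Finite ι] {A B C D : ℝ} {a b c d : ι → ℝ}
    (h : FP A B C D a b c d) : ∃ k, b k = B ∧ d k = D := by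
  obtain ⟨k, h1, h2⟩ := h.refl_x.transp.corner_hl
  exact ⟨k, by linarith, h1⟩

theorem many_of {ι : Type} {A B C D : ℝ} {a b c d : ι → ℝ} (p q r s : ℝ × ℝ)
    (h1 : p ≠ q) (h2 : p ≠ r) (h3 : p ≠ s) (h4 : q ≠ r) (h5 : q ≠ s) (h6 : r ≠ s)
    (hp : IsBd A B C D a b c d p) (hq : IsBd A B C D a b c d q) (hr : IsBd A B C D a b c d r)
    (hs : IsBd A B C D a b c d s) : Many A B C D a b c d := by
  classical
  refine ⟨{p, q, r, s}, ?_, ?_⟩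
  · rw [Finset.card_insert_of_notMem, Finset.card_insert_of_notMem, Finset.card_insert_of_notMem] <;>
      simp [*]
  · simp [hp, hq, hr, hs]

theorem FP.left_span {ι : Type} [Finite ι] {A B C D : ℝ} {a b c d : ι → ℝ}
    (h : FP A B C D a b c d) (hn : ∀ k1 k2 k3 : ι, ∃ m, m ≠ k1 ∧ m ≠ k2 ∧ m ≠ k3)
    (k1 : ι) (ha1 : a k1 = A) (hc1 : c k1 = C) (hd1 : d k1 = D) : Many A B C D a b c d := by
  obtain ⟨k2, hb2, hd2⟩ := h.corner_hh
  obtain ⟨k3, hb3, hc3⟩ := h.corner_hl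
  obtain ⟨m, hm1, hm2, hm3⟩ := hn k1 k2 k3
  have hAB := h.hAB
  have hCD := h.hCD
  have right : ∀ k, k ≠ k1 → b k1 ≤ a k := by
    intro k hk
    have := h.sep k k1 hk
    have := h.hA k
    have := h.hC k
    have := h.hD k
    have := h.ab k
    have := h.cd k
    rcases h.sep k k1 hk with h | h | h | h <;> linarith
  have ham := right m hm1
  have habm := h.ab m
  have hcdm := h.cd m
  have hBm := h.hB m
  have hCm := h.hC m
  have hDm := h.hD m
  have hab1 := h.ab k1
  have hab2 := h.ab k2
  have hab3 := h.ab k3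
  have hcd2 := h.cd k2
  have hcd3 := h.cd k3
  have hb1 : b k1 < B := by linarith
  have h21 : k2 ≠ k1 := by rintro rfl; linarith
  have h31 : k3 ≠ k1 := by rintro rfl; linarith
  have ha2 := right k2 h21
  have ha3 := right k3 h31
  have sep2 := h.sep m k2 hm2
  have sep3 := h.sep m k3 hm3
  have p1 : IsBd A B C D a b c d (b k1, C) :=
    ⟨⟨k1, Or.inr rfl, Or.inl hc1.symm⟩, Or.inl ⟨⟨by simp; linarith, by simp; linarith⟩, Or.inl rfl⟩⟩
  have p2 : IsBd A B C D a b c d (b k1, D) :=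
    ⟨⟨k1, Or.inr rfl, Or.inr hd1.symm⟩, Or.inl ⟨⟨by simp; linarith, by simp; linarith⟩, Or.inr rfl⟩⟩
  have q2 : b k1 < a k2 → IsBd A B C D a b c d (a k2, D) := fun _ =>
    ⟨⟨k2, Or.inl rfl, Or.inr hd2.symm⟩, Or.inl ⟨⟨by simp; linarith, by simp; linarith⟩, Or.inr rfl⟩⟩
  have q3 : b k1 < a k3 → IsBd A B C D a b c d (a k3, C) := fun _ =>
    ⟨⟨k3, Or.inl rfl, Or.inl hc3.symm⟩, Or.inl ⟨⟨by simp; linarith, by simp; linarith⟩, Or.inl rfl⟩⟩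
  have r2 : C < c k2 → IsBd A B C D a b c d (B, c k2) := fun _ =>
    ⟨⟨k2, Or.inr hb2.symm, Or.inl rfl⟩, Or.inr ⟨⟨by simp; linarith, by simp; linarith⟩, Or.inr rfl⟩⟩
  have r3 : d k3 < D → IsBd A B C D a b c d (B, d k3) := fun _ =>
    ⟨⟨k3, Or.inr hb3.symm, Or.inr rfl⟩, Or.inr ⟨⟨by simp; linarith, by simp; linarith⟩, Or.inr rfl⟩⟩
  have c2 : a k2 = b k1 → C < c k2 := by
    intro e
    by_contra! hc
    rcases sep2 with h | h | h | h <;> linarith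
  have d3 : a k3 = b k1 → d k3 < D := by
    intro e
    by_contra! hc
    rcases sep3 with h | h | h | h <;> linarith
  rcases ha2.lt_or_eq with e2 | e2 <;> rcases ha3.lt_or_eq with e3 | e3
  · apply many_of _ _ _ _ _ _ _ _ _ _ p1 p2 (q2 e2) (q3 e3) <;>
      simp only [ne_eq, Prod.mk.injEq, not_and_or] <;> grind
  · apply many_of _ _ _ _ _ _ _ _ _ _ p1 p2 (q2 e2) (r3 (d3 e3.symm)) <;>
      simp only [ne_eq, Prod.mk.injEq, not_and_or] <;> grind
  · apply many_of _ _ _ _ _ _ _ _ _ _ p1 p2 (q3 e3) (r2 (c2 e2.symm)) <;>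
      simp only [ne_eq, Prod.mk.injEq, not_and_or] <;> grind
  · have hne : c k2 ≠ d k3 := by
      intro e
      rcases sep2 with h | h | h | h <;> rcases sep3 with h' | h' | h' | h' <;> linarith
    apply many_of _ _ _ _ _ _ _ _ _ _ p1 p2 (r2 (c2 e2.symm)) (r3 (d3 e3.symm)) <;>
      simp only [ne_eq, Prod.mk.injEq, not_and_or] <;> grind

theorem FP.many {ι : Type} [Finite ι] {A B C D : ℝ} {a b c d : ι → ℝ}
    (h : FP A B C D a b c d) (hn : ∀ k1 k2 k3 : ι, ∃ m, m ≠ k1 ∧ m ≠ k2 ∧ m ≠ k3) :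
    Many A B C D a b c d := by
  by_cases hl : ∃ k, a k = A ∧ c k = C ∧ d k = D
  · obtain ⟨k, e1, e2, e3⟩ := hl
    exact h.left_span hn k e1 e2 e3
  by_cases hr : ∃ k, b k = B ∧ c k = C ∧ d k = D
  · obtain ⟨k, e1, e2, e3⟩ := hr
    exact (h.refl_x.left_span hn k (by simp [e1]) e2 e3).refl_x
  by_cases hbo : ∃ k, c k = C ∧ a k = A ∧ b k = B
  · obtain ⟨k, e1, e2, e3⟩ := hbo
    exact (h.transp.left_span hn k e1 e2 e3).transp
  by_cases hto : ∃ k, d k = D ∧ a k = A ∧ b k = B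
  · obtain ⟨k, e1, e2, e3⟩ := hto
    exact (h.transp.refl_x.left_span hn k (by simp [e1]) e2 e3).refl_x.transp
  push Not at hl hr hbo hto
  obtain ⟨k1, ha1, hc1⟩ := h.corner_ll
  obtain ⟨k2, hb2, hd2⟩ := h.corner_hh
  have hAB := h.hAB
  have hCD := h.hCD
  have hab1 := h.ab k1
  have hab2 := h.ab k2
  have hcd1 := h.cd k1
  have hcd2 := h.cd k2
  have f1 : d k1 < D := lt_of_le_of_ne (h.hD k1) (hl k1 ha1 hc1)
  have f2 : b k1 < B := lt_of_le_of_ne (h.hB k1) (hbo k1 hc1 ha1)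
  have f3 : C < c k2 := lt_of_le_of_ne (h.hC k2) (fun e => hr k2 hb2 e.symm hd2)
  have f4 : A < a k2 := lt_of_le_of_ne (h.hA k2) (fun e => hto k2 hd2 e.symm hb2)
  have p1 : IsBd A B C D a b c d (b k1, C) :=
    ⟨⟨k1, Or.inr rfl, Or.inl hc1.symm⟩, Or.inl ⟨⟨by simp; linarith, by simp; linarith⟩, Or.inl rfl⟩⟩
  have p2 : IsBd A B C D a b c d (A, d k1) :=
    ⟨⟨k1, Or.inl ha1.symm, Or.inr rfl⟩, Or.inr ⟨⟨by simp; linarith, by simp; linarith⟩, Or.inl rfl⟩⟩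
  have p3 : IsBd A B C D a b c d (a k2, D) :=
    ⟨⟨k2, Or.inl rfl, Or.inr hd2.symm⟩, Or.inl ⟨⟨by simp; linarith, by simp; linarith⟩, Or.inr rfl⟩⟩
  have p4 : IsBd A B C D a b c d (B, c k2) :=
    ⟨⟨k2, Or.inr hb2.symm, Or.inl rfl⟩, Or.inr ⟨⟨by simp; linarith, by simp; linarith⟩, Or.inr rfl⟩⟩
  apply many_of _ _ _ _ _ _ _ _ _ _ p1 p2 p3 p4 <;>
      simp only [ne_eq, Prod.mk.injEq, not_and_or] <;> grind

theorem adj_ends {n : ℕ} {A B C D : ℝ} {a b c d : Fin n → ℝ} (h : FP A B C D a b c d)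
    (i j : Fin n) (hij : (adjGraph a b c d).Adj i j) :
    ∃ p q : ℝ × ℝ, p ≠ q ∧
      (i ∈ cont a b c d p ∧ j ∈ cont a b c d p ∧ (i ∈ crn a b c d p ∨ j ∈ crn a b c d p)) ∧
      (i ∈ cont a b c d q ∧ j ∈ cont a b c d q ∧ (i ∈ crn a b c d q ∨ j ∈ crn a b c d q)) := by
  classical
  simp only [adjGraph, SimpleGraph.fromRel_adj] at hij
  obtain ⟨hne, hnt⟩ := hij
  have hnt : (Rect (a i) (b i) (c i) (d i) ∩ Rect (a j) (b j) (c j) (d j)).Nontrivial := by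
    rcases hnt with h | h
    · exact h
    · rwa [Set.inter_comm]
  obtain ⟨u, ⟨⟨hu1, hu2⟩, hu3, hu4⟩, v, ⟨⟨hv1, hv2⟩, hv3, hv4⟩, huv⟩ := hnt
  have hs := h.sep i j hne
  have := h.ab i
  have := h.ab j
  have := h.cd i
  have := h.cd j
  have huv' : u.1 ≠ v.1 ∨ u.2 ≠ v.2 := by
    by_contra! hc
    exact huv (Prod.ext hc.1 hc.2)
  simp only [Set.mem_Icc] at hu1 hu2 hu3 hu4 hv1 hv2 hv3 hv4
  refine ⟨(max (a i) (a j), max (c i) (c j)), (min (b i) (b j), min (d i) (d j)), ?_, ?_, ?_⟩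
  · rw [ne_eq, Prod.mk.injEq, not_and_or]
    grind
  · simp only [cont, crn, Rect, IsEnd, Finset.mem_filter, Finset.mem_univ, true_and,
      Set.mem_prod, Set.mem_Icc]
    grind
  · simp only [cont, crn, Rect, IsEnd, Finset.mem_filter, Finset.mem_univ, true_and,
      Set.mem_prod, Set.mem_Icc]
    grind

theorem stmt_12 {n : ℕ} (hn : 4 ≤ n) (A B C D : ℝ) (a b c d : Fin n → ℝ)
    (h : IsRFP A B C D a b c d) :
    (adjGraph a b c d).edgeSet.ncard ≤ 3 * n - 7 := by
  classical
  have hF := FP.of_rfp h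
  have h3 : ∀ p, (cont a b c d p).card ≤ 3 := by
    intro p
    have := h.2.2.2.2.2 p
    rwa [Set.ncard_eq_toFinset_card', Set.toFinset_ofPred] at this
  have hm : ∀ k1 k2 k3 : Fin n, ∃ m, m ≠ k1 ∧ m ≠ k2 ∧ m ≠ k3 := by
    intro k1 k2 k3
    have : ∃ m, m ∉ ({k1, k2, k3} : Finset (Fin n)) := by
      by_contra! hc
      have h1 : (Finset.univ : Finset (Fin n)) ⊆ {k1, k2, k3} := fun m _ => hc m
      have h2 := Finset.card_le_card h1
      have h3 := Finset.card_le_three (a := k1) (b := k2) (c := k3)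
      rw [Finset.card_univ, Fintype.card_fin] at h2
      omega
    obtain ⟨m, hm⟩ := this
    exact ⟨m, by simpa using hm⟩
  obtain ⟨S, hS4, hS⟩ := hF.many hm
  -- all rectangle corners
  let cs : Fin n → Finset (ℝ × ℝ) := fun k => ({a k, b k} : Finset ℝ) ×ˢ ({c k, d k} : Finset ℝ)
  have mem_cs : ∀ k p, p ∈ cs k ↔ k ∈ crn a b c d p := by
    intro k p
    rw [crn, Finset.mem_filter]
    simp [cs, IsEnd, Finset.mem_product]
  let Q : Finset (ℝ × ℝ) := Finset.univ.biUnion cs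
  have mem_Q : ∀ p, p ∈ Q ↔ (crn a b c d p).Nonempty := by
    intro p
    simp [Q, mem_cs, Finset.Nonempty]
  have cs_card : ∀ k, (cs k).card ≤ 4 := by
    intro k
    rw [Finset.card_product]
    exact Nat.mul_le_mul (Finset.card_le_two (a := a k) (b := b k))
      (Finset.card_le_two (a := c k) (b := d k))
  have sumN : ∑ p ∈ Q, (crn a b c d p).card ≤ 4 * n := by
    calc ∑ p ∈ Q, (crn a b c d p).card
        = ∑ p ∈ Q, ∑ k, if p ∈ cs k then 1 else 0 := by
          apply Finset.sum_congr rfl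
          intro p _
          rw [← Finset.card_filter]
          congr 1
          ext k
          simp [mem_cs]
      _ = ∑ k, ∑ p ∈ Q, if p ∈ cs k then 1 else 0 := Finset.sum_comm
      _ ≤ ∑ k : Fin n, 4 := by
          apply Finset.sum_le_sum
          intro k _
          rw [← Finset.card_filter]
          refine le_trans (Finset.card_le_card ?_) (cs_card k)
          intro p hp
          exact (Finset.mem_filter.1 hp).2
      _ = 4 * n := by simp [mul_comm]
  let V : Finset (ℝ × ℝ) := ({A, B} : Finset ℝ) ×ˢ ({C, D} : Finset ℝ)
  have mem_V : ∀ p, p ∈ V ↔ IsEnd A B p.1 ∧ IsEnd C D p.2 := by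
    intro p
    simp [V, IsEnd, Finset.mem_product]
  have hV : V.card = 4 := by
    rw [Finset.card_product, Finset.card_pair hF.hAB.ne, Finset.card_pair hF.hCD.ne]
  have wV : ∀ p ∈ V, wt A B p.1 * wt C D p.2 = 1 := by
    intro p hp
    rw [mem_V] at hp
    rw [wt_end hF.hAB hp.1, wt_end hF.hCD hp.2]
  have cV : ∀ p ∈ V, 1 ≤ (crn a b c d p).card := by
    intro p hp
    have := hF.crn_parity p
    rw [wV p hp] at this
    omega
  have VQ : V ⊆ Q := by
    intro p hp
    rw [mem_Q, ← Finset.card_pos]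
    exact cV p hp
  let P := Q \ V
  have cP : ∀ p ∈ P, 2 ≤ (crn a b c d p).card := by
    intro p hp
    obtain ⟨hq, hv⟩ := Finset.mem_sdiff.1 hp
    rw [mem_Q, ← Finset.card_pos] at hq
    have hev : (wt A B p.1 * wt C D p.2) % 2 = 0 := by
      rw [mem_V] at hv
      rcases wt_cases hF.hAB p.1 with ⟨e1, e2⟩ | ⟨e1, e2 | e2⟩ <;>
      rcases wt_cases hF.hCD p.2 with ⟨e3, e4⟩ | ⟨e3, e4 | e4⟩ <;> simp_all
    have := hF.crn_parity p
    omega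
  have hP : 2 * P.card + 4 ≤ 4 * n := by
    have e := Finset.sum_sdiff VQ (f := fun p => (crn a b c d p).card)
    have e1 := Finset.card_nsmul_le_sum V (fun p => (crn a b c d p).card) 1 cV
    have e2 := Finset.card_nsmul_le_sum P (fun p => (crn a b c d p).card) 2 cP
    simp only [smul_eq_mul] at e1 e2
    have e3 : ∑ p ∈ P, (crn a b c d p).card = ∑ p ∈ Q \ V, (crn a b c d p).card := rfl
    omega
  have wS : ∀ p ∈ S, wt A B p.1 * wt C D p.2 = 2 := by
    intro p hp
    rcases (hS p hp).2 with ⟨e1, e2⟩ | ⟨e1, e2⟩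
    · rw [wt_in e1.1 e1.2, wt_end hF.hCD e2]
    · rw [wt_in e1.1 e1.2, wt_end hF.hAB e2]
  have SP : S ⊆ P := by
    intro p hp
    refine Finset.mem_sdiff.2 ⟨?_, ?_⟩
    · rw [mem_Q]
      obtain ⟨k, hk⟩ := (hS p hp).1
      exact ⟨k, by simpa [crn] using hk⟩
    · intro hv
      have := wV p hv
      have := wS p hp
      omega
  -- ordered adjacent pairs
  let T : Finset (Fin n × Fin n) :=
    Finset.univ.filter fun q => (adjGraph a b c d).Adj q.1 q.2
  have hT : T.card = 2 * (adjGraph a b c d).edgeSet.ncard := by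
    have e1 := (adjGraph a b c d).sum_degrees_eq_twice_card_edges
    rw [Set.ncard_eq_toFinset_card', ← SimpleGraph.edgeFinset, ← e1, Finset.card_filter,
      ← Finset.univ_product_univ, Finset.sum_product]
    apply Finset.sum_congr rfl
    intro i _
    rw [← Finset.card_filter, ← SimpleGraph.card_neighborFinset_eq_degree]
    congr 1
    ext j
    simp
  let inc : Fin n × Fin n → ℝ × ℝ → Prop := fun q p =>
    q ∈ (cont a b c d p).offDiag
  have hdeg : ∀ q ∈ T, 2 ≤ (P.filter (inc q)).card := by
    intro q hq
    have hadj := (Finset.mem_filter.1 hq).2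
    obtain ⟨p, p', hne, hp, hp'⟩ := adj_ends hF q.1 q.2 hadj
    have key : ∀ p, (q.1 ∈ cont a b c d p ∧ q.2 ∈ cont a b c d p ∧
        (q.1 ∈ crn a b c d p ∨ q.2 ∈ crn a b c d p)) → p ∈ P.filter (inc q) := by
      intro p hp
      have hoff : inc q p := Finset.mem_offDiag.2 ⟨hp.1, hp.2.1, hadj.ne⟩
      refine Finset.mem_filter.2 ⟨Finset.mem_sdiff.2 ⟨?_, ?_⟩, hoff⟩
      · rw [mem_Q]
        rcases hp.2.2 with e | e
        · exact ⟨_, e⟩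
        · exact ⟨_, e⟩
      · intro hv
        have e1 := hF.cont_le p
        rw [wV p hv] at e1
        exact hadj.ne (Finset.card_le_one.1 e1 _ hp.1 _ hp.2.1)
    rw [← Finset.card_pair hne]
    apply Finset.card_le_card
    intro x hx
    rcases Finset.mem_insert.1 hx with rfl | hx
    · exact key _ hp
    · rw [Finset.mem_singleton.1 hx]
      exact key _ hp'
  have hT2 : 2 * T.card ≤ ∑ p ∈ P, ((cont a b c d p).offDiag).card := by
    calc 2 * T.card = ∑ q ∈ T, 2 := by simp [mul_comm]
      _ ≤ ∑ q ∈ T, (P.filter (inc q)).card := Finset.sum_le_sum hdeg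
      _ = ∑ p ∈ P, (T.filter fun q => inc q p).card := by
          simp only [Finset.card_filter]
          exact Finset.sum_comm
      _ ≤ _ := by
          apply Finset.sum_le_sum
          intro p _
          apply Finset.card_le_card
          intro q hq
          exact (Finset.mem_filter.1 hq).2
  have o6 : ∀ p ∈ P \ S, ((cont a b c d p).offDiag).card ≤ 6 := by
    intro p _
    rw [Finset.offDiag_card]
    have := h3 p
    generalize (cont a b c d p).card = m at *
    interval_cases m <;> simp
  have o2 : ∀ p ∈ S, ((cont a b c d p).offDiag).card ≤ 2 := by
    intro p hp
    rw [Finset.offDiag_card]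
    have := hF.cont_le p
    rw [wS p hp] at this
    generalize (cont a b c d p).card = m at *
    interval_cases m <;> simp
  have e := Finset.sum_sdiff SP (f := fun p => ((cont a b c d p).offDiag).card)
  have e6 := Finset.sum_le_card_nsmul _ _ _ o6
  have e2 := Finset.sum_le_card_nsmul _ _ _ o2
  have e3 := Finset.card_sdiff_add_card_eq_card SP
  simp only [smul_eq_mul] at e6 e2
  omega
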